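/- Every grid function $v$ vanishing on the boundary satisfies $\|v\|^2\le\frac{L_1^2L_2^2}{6(L_1^2+L_2^2)}\,|v|_1^2$; in particular, when $L_1=L_2=1$ this gives $\|v\|\le\frac{1}{2\sqrt{3}}|v|_1$. -/

import Mathlib

open Finset

/-- Squared discrete L² norm of a grid function. -/
noncomputable def gridNormSq (h₁ h₂ : ℝ) (M₁ M₂ : ℕ) (v : ℕ → ℕ → ℝ) : ℝ :=
  h₁ * h₂ * ∑ i ∈ Finset.Icc 1 (M₁ - 1), ∑ j ∈ Finset.Icc 1 (M₂ - 1), (v i j) ^ 2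

/-- Squared discrete H¹ seminorm  |v|₁² = ‖δₓv‖² + ‖δ_yv‖². -/
noncomputable def gridSemiSq (h₁ h₂ : ℝ) (M₁ M₂ : ℕ) (v : ℕ → ℕ → ℝ) : ℝ :=
  h₁ * h₂ * ∑ i ∈ Finset.Icc 1 M₁, ∑ j ∈ Finset.Icc 1 (M₂ - 1),
      ((v i j - v (i - 1) j) / h₁) ^ 2
  + h₁ * h₂ * ∑ i ∈ Finset.Icc 1 (M₁ - 1), ∑ j ∈ Finset.Icc 1 M₂,
      ((v i j - v i (j - 1)) / h₂) ^ 2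

lemma aux_cs (u : ℕ → ℝ) (a b : ℕ) (hab : a ≤ b) :
    (u b - u a) ^ 2 ≤ ((b : ℝ) - a) * ∑ k ∈ Finset.Ico a b, (u (k + 1) - u k) ^ 2 := by
  have h := sq_sum_le_card_mul_sum_sq (s := Finset.Ico a b) (f := fun k => u (k + 1) - u k)
  rw [Finset.sum_Ico_sub u hab] at h
  rw [Nat.card_Ico, Nat.cast_sub hab] at h
  exact h

lemma aux_sum (M : ℕ) (c : ℝ) :
    6 * ∑ i ∈ Finset.range M, (i : ℝ) * (c - i)
      = 3 * c * M * (M - 1) - (M - 1) * M * (2 * M - 1) := by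
  induction M with
  | zero => simp
  | succ n ih => rw [Finset.sum_range_succ, mul_add, ih]; push_cast; ring

lemma aux_1d (M : ℕ) (hM : 2 ≤ M) (u : ℕ → ℝ) (h0 : u 0 = 0) (h1 : u M = 0) :
    6 * ∑ i ∈ Finset.Icc 1 (M - 1), u i ^ 2
      ≤ (M : ℝ) ^ 2 * ∑ i ∈ Finset.Icc 1 M, (u i - u (i - 1)) ^ 2 := by
  have e1 : ∑ i ∈ Finset.Icc 1 M, (u i - u (i - 1)) ^ 2
      = ∑ k ∈ Finset.Ico 0 M, (u (k + 1) - u k) ^ 2 := by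
    have h := Finset.sum_Ico_add' (fun i => (u i - u (i - 1)) ^ 2) 0 M 1
    have hI : Finset.Icc 1 M = Finset.Ico (0 + 1) (M + 1) := by
      ext i
      simp
    rw [hI, ← h]
    simp
  have e2 : ∑ i ∈ Finset.Icc 1 (M - 1), u i ^ 2 = ∑ i ∈ Finset.range M, u i ^ 2 := by
    apply Finset.sum_subset
    · intro i hi
      simp at hi ⊢
      omega
    · intro i hi hn
      have : i = 0 := by
        simp at hi hn
        omega
      simp [this, h0]
  rw [e1, e2]
  set D := ∑ k ∈ Finset.Ico 0 M, (u (k + 1) - u k) ^ 2 with hD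
  have hD0 : 0 ≤ D := Finset.sum_nonneg fun _ _ => sq_nonneg _
  have hMpos : (0 : ℝ) < M := by positivity
  have key : ∀ i ∈ Finset.range M, (M : ℝ) * u i ^ 2 ≤ ((i : ℝ) * (M - i)) * D := by
    intro i hi
    have hi' : i ≤ M := (Finset.mem_range.mp hi).le
    have hiR : (i : ℝ) ≤ M := by exact_mod_cast hi'
    have a := aux_cs u 0 i (Nat.zero_le _)
    have b := aux_cs u i M hi'
    have s := Finset.sum_Ico_consecutive (fun k => (u (k + 1) - u k) ^ 2) (Nat.zero_le i) hi'
    rw [← hD] at s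
    rw [h0] at a
    rw [h1] at b
    have a' := mul_le_mul_of_nonneg_left a (sub_nonneg.mpr hiR)
    have b' := mul_le_mul_of_nonneg_left b (Nat.cast_nonneg (α := ℝ) i)
    rw [← s]
    push_cast at a'
    linarith
  have hs := Finset.sum_le_sum key
  rw [← Finset.mul_sum, ← Finset.sum_mul] at hs
  have e := aux_sum M M
  refine le_of_mul_le_mul_left ?_ hMpos
  have hx : (6 * ∑ i ∈ Finset.range M, (i : ℝ) * (M - i)) * D ≤ (M : ℝ) ^ 3 * D := by
    apply mul_le_mul_of_nonneg_right _ hD0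
    rw [e]
    nlinarith
  nlinarith

theorem stmt_3 (M₁ M₂ : ℕ) (hM₁ : 2 ≤ M₁) (hM₂ : 2 ≤ M₂)
    (L₁ L₂ : ℝ) (hL₁ : 0 < L₁) (hL₂ : 0 < L₂)
    (h₁ h₂ : ℝ) (hh₁ : h₁ = L₁ / M₁) (hh₂ : h₂ = L₂ / M₂)
    (v : ℕ → ℕ → ℝ)
    (hbd : ∀ i j : ℕ, i ≤ M₁ → j ≤ M₂ → (i = 0 ∨ i = M₁ ∨ j = 0 ∨ j = M₂) → v i j = 0) :
    gridNormSq h₁ h₂ M₁ M₂ v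
      ≤ L₁ ^ 2 * L₂ ^ 2 / (6 * (L₁ ^ 2 + L₂ ^ 2)) * gridSemiSq h₁ h₂ M₁ M₂ v
    ∧ (L₁ = 1 → L₂ = 1 →
        Real.sqrt (gridNormSq h₁ h₂ M₁ M₂ v)
          ≤ 1 / (2 * Real.sqrt 3) * Real.sqrt (gridSemiSq h₁ h₂ M₁ M₂ v)) := by
  have main : gridNormSq h₁ h₂ M₁ M₂ v
      ≤ L₁ ^ 2 * L₂ ^ 2 / (6 * (L₁ ^ 2 + L₂ ^ 2)) * gridSemiSq h₁ h₂ M₁ M₂ v := by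
    have hm1 : (0 : ℝ) < M₁ := by positivity
    have hm2 : (0 : ℝ) < M₂ := by positivity
    have p1 : 0 < h₁ := by rw [hh₁]; positivity
    have p2 : 0 < h₂ := by rw [hh₂]; positivity
    have HY : 6 * ∑ i ∈ Finset.Icc 1 (M₁ - 1), ∑ j ∈ Finset.Icc 1 (M₂ - 1), (v i j) ^ 2
        ≤ (M₂ : ℝ) ^ 2 * ∑ i ∈ Finset.Icc 1 (M₁ - 1), ∑ j ∈ Finset.Icc 1 M₂,
          (v i j - v i (j - 1)) ^ 2 := by
      rw [Finset.mul_sum, Finset.mul_sum]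
      apply Finset.sum_le_sum
      intro i hi
      have hi' : i ≤ M₁ := by simp at hi; omega
      exact aux_1d M₂ hM₂ (v i) (hbd i 0 hi' (by omega) (by simp))
        (hbd i M₂ hi' le_rfl (by simp))
    have HX : 6 * ∑ i ∈ Finset.Icc 1 (M₁ - 1), ∑ j ∈ Finset.Icc 1 (M₂ - 1), (v i j) ^ 2
        ≤ (M₁ : ℝ) ^ 2 * ∑ i ∈ Finset.Icc 1 M₁, ∑ j ∈ Finset.Icc 1 (M₂ - 1),
          (v i j - v (i - 1) j) ^ 2 := by
      rw [Finset.sum_comm, Finset.sum_comm (s := Finset.Icc 1 M₁), Finset.mul_sum, Finset.mul_sum]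
      apply Finset.sum_le_sum
      intro j hj
      have hj' : j ≤ M₂ := by simp at hj; omega
      exact aux_1d M₁ hM₁ (fun i => v i j) (hbd 0 j (by omega) hj' (by simp))
        (hbd M₁ j le_rfl hj' (by simp))
    unfold gridNormSq gridSemiSq
    simp only [div_pow, ← Finset.sum_div]
    generalize (∑ i ∈ Finset.Icc 1 (M₁ - 1), ∑ j ∈ Finset.Icc 1 (M₂ - 1), (v i j) ^ 2) = N at *
    generalize (∑ i ∈ Finset.Icc 1 M₁, ∑ j ∈ Finset.Icc 1 (M₂ - 1),
          (v i j - v (i - 1) j) ^ 2) = X at *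
    generalize (∑ i ∈ Finset.Icc 1 (M₁ - 1), ∑ j ∈ Finset.Icc 1 M₂,
          (v i j - v i (j - 1)) ^ 2) = Y at *
    have ex : X / h₁ ^ 2 = M₁ ^ 2 * X / L₁ ^ 2 := by rw [hh₁]; field_simp
    have ey : Y / h₂ ^ 2 = M₂ ^ 2 * Y / L₂ ^ 2 := by rw [hh₂]; field_simp
    rw [ex, ey]
    have hN : N = L₁ ^ 2 * L₂ ^ 2 / (6 * (L₁ ^ 2 + L₂ ^ 2)) *
        (6 * N / L₁ ^ 2 + 6 * N / L₂ ^ 2) := by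
      field_simp
      ring
    calc h₁ * h₂ * N = h₁ * h₂ * (L₁ ^ 2 * L₂ ^ 2 / (6 * (L₁ ^ 2 + L₂ ^ 2)) *
        (6 * N / L₁ ^ 2 + 6 * N / L₂ ^ 2)) := by rw [← hN]
      _ ≤ h₁ * h₂ * (L₁ ^ 2 * L₂ ^ 2 / (6 * (L₁ ^ 2 + L₂ ^ 2)) *
        (M₁ ^ 2 * X / L₁ ^ 2 + M₂ ^ 2 * Y / L₂ ^ 2)) := by gcongr
      _ = _ := by ring
  refine ⟨main, ?_⟩
  intro e1 e2
  subst e1 e2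
  have hc : (1 : ℝ) / (2 * Real.sqrt 3) = Real.sqrt (1 / 12) := by
    rw [show (1 : ℝ) / 12 = (1 / (2 * Real.sqrt 3)) ^ 2 by
      rw [div_pow, mul_pow, Real.sq_sqrt (by norm_num)]; norm_num]
    rw [Real.sqrt_sq (by positivity)]
  rw [hc, ← Real.sqrt_mul (by norm_num)]
  apply Real.sqrt_le_sqrt
  refine main.trans (le_of_eq ?_)
  norm_num
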